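/- Let m ≥ 4 and let e be an integer with 1 ≤ e < m/2 such that m/gcd(m,e) is even, and set ℓ = 2·gcd(m,e). Then the supports of the codewords of C̄_e^⊥ of a fixed weight k form the blocks of a 2-(2^m, k, λ) design on the point set F for each of the following pairs: (i) k = 2^{m−1}±2^{(m+ℓ−2)/2} with λ = k(k−1)/(2^ℓ(2^{ℓ/2}+1)); (ii) k = 2^{m−1}±2^{(m−2)/2} with λ = 2^{(m+ℓ−2)/2}(2^{m/2}±1)(k−1)/(2^{ℓ/2}+1) (signs taken consistently); (iii) k = 2^{m−1} with λ = ((2^{ℓ/2}−1)·2^{m−ℓ}+1)(2^{m−1}−1). That is, for each such (k,λ), every 2-element subset of F is contained in the supports of exactly λ codewords of C̄_e^⊥ of weight k. -/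

import Mathlib

noncomputable local instance (m : ℕ) : Fintype (GaloisField 2 m) := Fintype.ofFinite _
attribute [local instance] Classical.propDecidable

/-- `∑_{g∈F} ι(c(g))·g^s ∈ F = GF(2^m)`, where `ι : 𝔽₂ → F` is the unique ring hom. -/
noncomputable def phiF (m s : ℕ) :
    (GaloisField 2 m → ZMod 2) →ₗ[ZMod 2] GaloisField 2 m where
  toFun c := ∑ g, algebraMap (ZMod 2) (GaloisField 2 m) (c g) * g ^ s
  map_add' c d := by simp [add_mul, Finset.sum_add_distrib]
  map_smul' a c := by simp [Algebra.smul_def, mul_assoc, Finset.mul_sum]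

/-- The parity functional `c ↦ ∑_{g∈F} c(g) ∈ 𝔽₂`. -/
noncomputable def parF (m : ℕ) : (GaloisField 2 m → ZMod 2) →ₗ[ZMod 2] ZMod 2 where
  toFun c := ∑ g, c g
  map_add' c d := by simp [Finset.sum_add_distrib]
  map_smul' a c := by simp [Finset.mul_sum]

/-- The extended binary cyclic code `C̄_e` of length `2^m`, with coordinates indexed by
`F = GF(2^m)`: all `c : F → 𝔽₂` with `∑_{g∈F} c(g) = 0` in `𝔽₂`,
`∑_{g∈F} ι(c(g))·g = 0` and `∑_{g∈F} ι(c(g))·g^{2^e+1} = 0` in `F`. -/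
noncomputable def extCode (m e : ℕ) : Submodule (ZMod 2) (GaloisField 2 m → ZMod 2) :=
  LinearMap.ker (parF m) ⊓ LinearMap.ker (phiF m 1) ⊓ LinearMap.ker (phiF m (2 ^ e + 1))

/-- The dual code `C̄_e^⊥`. -/
noncomputable def dualCode (m e : ℕ) : Submodule (ZMod 2) (GaloisField 2 m → ZMod 2) where
  carrier := {y | ∀ c ∈ extCode m e, ∑ g, c g * y g = 0}
  add_mem' := by
    intro a b ha hb c hc
    simp only [Pi.add_apply, mul_add, Finset.sum_add_distrib, ha c hc, hb c hc, add_zero]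
  zero_mem' := by intro c hc; simp
  smul_mem' := by
    intro a y hy c hc
    simp only [Pi.smul_apply, smul_eq_mul, mul_left_comm, ← Finset.mul_sum, hy c hc, mul_zero]

/-- The Hamming weight of a codeword. -/
noncomputable def wt {m : ℕ} (y : GaloisField 2 m → ZMod 2) : ℕ :=
  (Finset.univ.filter fun g => y g ≠ 0).card


/-- The nontrivial character of `𝔽₂` with values in `ℤ`. -/
def signChar (t : ZMod 2) : ℤ := if t = 0 then 1 else -1

lemma signChar_add (s t : ZMod 2) : signChar (s + t) = signChar s * signChar t := by
  revert s t; decide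

lemma signChar_zero : signChar 0 = 1 := rfl

lemma signChar_eq (t : ZMod 2) : signChar t = 1 - 2 * if t ≠ 0 then 1 else 0 := by
  revert t; decide

lemma zmod_two_add_self (t : ZMod 2) : t + t = 0 := by revert t; decide

lemma sum_signChar_addMonoidHom {G : Type*} [AddCommGroup G] [Fintype G] (f : G →+ ZMod 2) :
    ∑ x, signChar (f x) = if f = 0 then (Fintype.card G : ℤ) else 0 := by
  split_ifs with h
  · simp [h, signChar_zero]
  · obtain ⟨x₀, hx₀⟩ : ∃ x₀, f x₀ ≠ 0 := by
      by_contra! h'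
      exact h (AddMonoidHom.ext h')
    have h1 : ∑ x, signChar (f x) = ∑ x, signChar (f (x₀ + x)) :=
      (Equiv.sum_comp (Equiv.addLeft x₀) fun x => signChar (f x)).symm
    have h2 : signChar (f x₀) = -1 := by rw [signChar, if_neg hx₀]
    simp only [map_add, signChar_add, ← Finset.mul_sum, h2] at h1
    linarith

lemma IsCyclic.card_filter_pow_eq_one {G : Type*} [CommGroup G] [IsCyclic G] [Fintype G] (n : ℕ) :
    (Finset.univ.filter fun z : G => z ^ n = 1).card = (Fintype.card G).gcd n := by
  have h := IsCyclic.card_powMonoidHom_ker (G := G) n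
  rw [Nat.card_eq_fintype_card, Nat.card_eq_fintype_card] at h
  rw [← h, ← Fintype.card_subtype]
  exact Fintype.card_congr (Equiv.subtypeEquivRight fun z => by simp [MonoidHom.mem_ker])

lemma card_filter_mul_pow_eq_one {G : Type*} [CommGroup G] [IsCyclic G] [Fintype G]
    {a z : G} {p q : ℕ} (h : a ^ p * z ^ q = 1) :
    (Finset.univ.filter fun x : G => a ^ p * x ^ q = 1).card = (Fintype.card G).gcd q := by
  rw [← IsCyclic.card_filter_pow_eq_one]
  refine Finset.card_nbij' (fun x => x * z⁻¹) (fun x => x * z) ?_ ?_ ?_ ?_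
  · intro x hx
    simp only [Finset.coe_filter, Finset.mem_univ, true_and, Set.mem_ofPred_eq] at hx ⊢
    rw [mul_pow, inv_pow, mul_inv_eq_one]
    exact mul_left_cancel (hx.trans h.symm)
  · intro x hx
    simp only [Finset.coe_filter, Finset.mem_univ, true_and, Set.mem_ofPred_eq] at hx ⊢
    rw [mul_pow, hx, one_mul, h]
  · intro x _; simp
  · intro x _; simp

lemma card_filter_exists_mul_pow_eq_one {G : Type*} [CommGroup G] [IsCyclic G] [Fintype G]
    (p r : ℕ) :
    (Finset.univ.filter fun a : G => ∃ z : G, a ^ p * z ^ (r * p) = 1).card *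
        (Fintype.card G).gcd (r * p) =
      Fintype.card G * (Fintype.card G).gcd p := by
  have h1 : ∑ a : G, (Finset.univ.filter fun z : G => a ^ p * z ^ (r * p) = 1).card =
      (Finset.univ.filter fun a : G => ∃ z : G, a ^ p * z ^ (r * p) = 1).card *
        (Fintype.card G).gcd (r * p) := by
    rw [Finset.card_filter, Finset.sum_mul]
    refine Finset.sum_congr rfl fun a _ => ?_
    split_ifs with h
    · obtain ⟨z, hz⟩ := h
      rw [card_filter_mul_pow_eq_one hz, one_mul]
    · rw [zero_mul, Finset.card_eq_zero, Finset.filter_eq_empty_iff]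
      intro z _ hz
      exact h ⟨z, hz⟩
  rw [← h1]
  simp only [Finset.card_filter]
  rw [Finset.sum_comm, ← IsCyclic.card_filter_pow_eq_one p, ← Finset.card_univ, Finset.card_eq_sum_ones,
    Finset.sum_mul]
  refine Finset.sum_congr rfl fun z _ => ?_
  rw [one_mul, Finset.card_filter]
  refine Fintype.sum_equiv (Equiv.mulRight (z ^ r)) _ _ fun a => ?_
  simp [mul_pow, pow_mul]

lemma two_pow_add_one_mul_sub_one (e : ℕ) : (2 ^ e + 1) * (2 ^ e - 1) = 2 ^ (2 * e) - 1 := by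
  rw [two_mul, pow_add]
  simpa using (Nat.mul_self_sub_mul_self_eq (2 ^ e) 1).symm

lemma gcd_card_units {K : Type*} [Field K] [Fintype K] {m : ℕ} (hK : Fintype.card K = 2 ^ m)
    (k : ℕ) : (Fintype.card Kˣ).gcd (2 ^ k - 1) = 2 ^ m.gcd k - 1 := by
  rw [Fintype.card_units, hK, Nat.pow_sub_one_gcd_pow_sub_one]

section Field

variable {F : Type*} [Field F] [Fintype F] [Algebra (ZMod 2) F]

local notation "Tr" => Algebra.trace (ZMod 2) F

lemma trace_pow_two_pow (e : ℕ) (x : F) : Tr (x ^ 2 ^ e) = Tr x := by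
  have := Algebra.trace_eq_of_algEquiv
    (FiniteField.frobeniusAlgEquivOfAlgebraic (ZMod 2) F ^ e) x
  rw [← this, AlgEquiv.coe_pow, FiniteField.coe_frobeniusAlgEquivOfAlgebraic_iterate, ZMod.card]

lemma trace_mul_left_eq_zero {a : F} (h : ∀ x, Tr (a * x) = 0) : a = 0 :=
  (traceForm_nondegenerate (ZMod 2) F).1 a fun x => by rw [Algebra.traceForm_apply, h]

lemma exists_eq_trace_mul (f : F →ₗ[ZMod 2] ZMod 2) : ∃ a, ∀ x, f x = Tr (a * x) := by
  refine ⟨(LinearMap.BilinForm.toDual (Algebra.traceForm (ZMod 2) F)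
    (traceForm_nondegenerate (ZMod 2) F)).symm f, fun x => ?_⟩
  rw [← Algebra.traceForm_apply, LinearMap.BilinForm.apply_toDual_symm_apply]

lemma charP_two_of_algebra : CharP F 2 := charP_of_injective_algebraMap' (ZMod 2) (A := F) 2

lemma add_pow_two_pow (e : ℕ) (x y : F) : (x + y) ^ 2 ^ e = x ^ 2 ^ e + y ^ 2 ^ e := by
  have := charP_two_of_algebra (F := F)
  exact add_pow_char_pow x y 2 e

lemma surjective_pow_two_pow (e : ℕ) : Function.Surjective fun x : F => x ^ 2 ^ e := by
  have := (FiniteField.frobeniusAlgEquivOfAlgebraic (ZMod 2) F ^ e).surjective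
  rwa [AlgEquiv.coe_pow, FiniteField.coe_frobeniusAlgEquivOfAlgebraic_iterate, ZMod.card] at this

lemma sum_signChar_trace_mul (a : F) :
    ∑ x, signChar (Tr (a * x)) = if a = 0 then (Fintype.card F : ℤ) else 0 := by
  have h := sum_signChar_addMonoidHom ((Tr).toAddMonoidHom.comp (AddMonoidHom.mulLeft a))
  refine h.trans (if_congr ⟨fun h => ?_, ?_⟩ rfl rfl)
  · exact trace_mul_left_eq_zero fun x => DFunLike.congr_fun h x
  · rintro rfl
    ext x
    simp

/-- The exponential sum `∑_g (-1)^{Tr(a g^{2^e+1} + b g)}`. -/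
noncomputable def goldSum (e : ℕ) (a b : F) : ℤ :=
  ∑ g, signChar (Tr (a * g ^ (2 ^ e + 1)) + Tr (b * g))

/-- The radical of the bilinear form attached to the quadratic form `Tr(a g^{2^e+1})`. -/
def goldRadical (e : ℕ) (a : F) : AddSubgroup F where
  carrier := {z | a * z + a ^ 2 ^ e * z ^ 2 ^ (2 * e) = 0}
  zero_mem' := by simp
  add_mem' {x y} hx hy := by
    simp only [Set.mem_ofPred_eq, add_pow_two_pow] at *
    linear_combination hx + hy
  neg_mem' {x} hx := by
    have := charP_two_of_algebra (F := F)
    simpa [CharTwo.neg_eq] using hx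

lemma mem_goldRadical {e : ℕ} {a z : F} :
    z ∈ goldRadical e a ↔ a * z + a ^ 2 ^ e * z ^ 2 ^ (2 * e) = 0 := Iff.rfl

lemma trace_polar (e : ℕ) (a x z : F) :
    Tr (a * (x + z) ^ (2 ^ e + 1)) = Tr (a * x ^ (2 ^ e + 1)) + Tr (a * z ^ (2 ^ e + 1)) +
      Tr ((a * z + a ^ 2 ^ e * z ^ 2 ^ (2 * e)) * x ^ 2 ^ e) := by
  have h : Tr (a * z ^ 2 ^ e * x) = Tr (a ^ 2 ^ e * z ^ 2 ^ (2 * e) * x ^ 2 ^ e) := by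
    rw [← trace_pow_two_pow e, mul_pow, mul_pow, ← pow_mul, ← pow_add, two_mul]
  rw [add_mul, map_add, ← h, ← map_add, ← map_add, ← map_add, pow_succ, add_pow_two_pow]
  congr 1
  ring

lemma sum_signChar_trace_mul_pow (e : ℕ) (w : F) :
    ∑ x, signChar (Tr (w * x ^ 2 ^ e)) = if w = 0 then (Fintype.card F : ℤ) else 0 := by
  rw [← sum_signChar_trace_mul]
  have hb : Function.Bijective fun x : F => x ^ 2 ^ e :=
    Finite.injective_iff_bijective.mp
      (Finite.injective_iff_surjective.mpr (surjective_pow_two_pow e))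
  exact hb.sum_comp fun x => signChar (Tr (w * x))

lemma goldSum_sq (e : ℕ) (a b : F) :
    goldSum e a b ^ 2 = Fintype.card F *
      ∑ z : goldRadical e a, signChar (Tr (a * (z : F) ^ (2 ^ e + 1)) + Tr (b * z)) := by
  have key : ∀ x z : F, signChar (Tr (a * x ^ (2 ^ e + 1)) + Tr (b * x)) *
      signChar (Tr (a * (x + z) ^ (2 ^ e + 1)) + Tr (b * (x + z))) =
      signChar (Tr (a * z ^ (2 ^ e + 1)) + Tr (b * z)) *
        signChar (Tr ((a * z + a ^ 2 ^ e * z ^ 2 ^ (2 * e)) * x ^ 2 ^ e)) := by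
    intro x z
    rw [← signChar_add, ← signChar_add, trace_polar, mul_add b, map_add]
    congr 1
    linear_combination zmod_two_add_self (Tr (a * x ^ (2 ^ e + 1))) + zmod_two_add_self (Tr (b * x))
  calc goldSum e a b ^ 2
      = ∑ x, ∑ z, signChar (Tr (a * x ^ (2 ^ e + 1)) + Tr (b * x)) *
          signChar (Tr (a * (x + z) ^ (2 ^ e + 1)) + Tr (b * (x + z))) := by
        rw [sq, goldSum, Finset.sum_mul]
        refine Finset.sum_congr rfl fun x _ => ?_
        rw [← Finset.mul_sum]
        congr 1
        exact (Equiv.sum_comp (Equiv.addLeft x) fun y =>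
          signChar (Tr (a * y ^ (2 ^ e + 1)) + Tr (b * y))).symm
    _ = ∑ z, signChar (Tr (a * z ^ (2 ^ e + 1)) + Tr (b * z)) *
          (if z ∈ goldRadical e a then (Fintype.card F : ℤ) else 0) := by
        rw [Finset.sum_comm]
        simp only [key, ← Finset.mul_sum, sum_signChar_trace_mul_pow, mem_goldRadical]
    _ = _ := by
        simp only [mul_ite, mul_zero]
        rw [← Finset.sum_filter, Finset.mul_sum]
        simp only [mul_comm (Fintype.card F : ℤ)]
        exact (Finset.sum_subtype (p := (· ∈ goldRadical e a)) _ (by simp) (fun z =>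
          signChar (Tr (a * z ^ (2 ^ e + 1)) + Tr (b * z)) * (Fintype.card F : ℤ)))

lemma goldSum_sq_eq_or (e : ℕ) (a b : F) :
    goldSum e a b ^ 2 = 0 ∨
      goldSum e a b ^ 2 = Fintype.card F * Nat.card (goldRadical e a) := by
  let f : goldRadical e a →+ ZMod 2 :=
    { toFun := fun z => Tr (a * (z : F) ^ (2 ^ e + 1)) + Tr (b * z)
      map_zero' := by simp
      map_add' := fun x z => by
        rw [AddSubgroup.coe_add, trace_polar, mem_goldRadical.mp z.2, mul_add, map_add]
        simp only [zero_mul, map_zero]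
        ring }
  rw [goldSum_sq]
  have h : ∑ z : goldRadical e a, signChar (Tr (a * (z : F) ^ (2 ^ e + 1)) + Tr (b * z)) =
      if f = 0 then (Fintype.card (goldRadical e a) : ℤ) else 0 := sum_signChar_addMonoidHom f
  rw [h]
  split_ifs
  · right; rw [Nat.card_eq_fintype_card]
  · left; simp

lemma sum_goldSum_sq (e : ℕ) (a : F) :
    ∑ b, goldSum e a b ^ 2 = (Fintype.card F : ℤ) ^ 2 := by
  simp only [goldSum_sq, ← Finset.mul_sum, signChar_add]
  rw [Finset.sum_comm, sq]
  congr 1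
  simp only [← Finset.mul_sum, mul_comm _ (Subtype.val _), sum_signChar_trace_mul]
  rw [Finset.sum_eq_single (0 : goldRadical e a)]
  · simp [signChar_zero]
  · intro z _ hz
    simp [hz]
  · simp

lemma card_goldSum_sq_mul (e : ℕ) (a : F) :
    (Finset.univ.filter fun b : F =>
        goldSum e a b ^ 2 = Fintype.card F * Nat.card (goldRadical e a)).card *
      Nat.card (goldRadical e a) = Fintype.card F := by
  have hq : (Fintype.card F : ℤ) ≠ 0 := by exact_mod_cast Fintype.card_ne_zero
  have h := sum_goldSum_sq e a
  have h2 : ∑ b, goldSum e a b ^ 2 = ∑ b : F, if goldSum e a b ^ 2 =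
      Fintype.card F * Nat.card (goldRadical e a) then
        (Fintype.card F * Nat.card (goldRadical e a) : ℤ) else 0 := by
    refine Finset.sum_congr rfl fun b _ => ?_
    split_ifs with hb
    · exact hb
    · exact (goldSum_sq_eq_or e a b).resolve_right hb
  rw [h2, ← Finset.sum_filter, Finset.sum_const, nsmul_eq_mul] at h
  have : (Fintype.card F : ℤ) * (((Finset.univ.filter fun b : F =>
      goldSum e a b ^ 2 = Fintype.card F * Nat.card (goldRadical e a)).card : ℤ) *
      Nat.card (goldRadical e a)) = Fintype.card F * Fintype.card F := by linarith
  exact_mod_cast mul_left_cancel₀ hq this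

lemma unit_mem_goldRadical {e : ℕ} (a z : Fˣ) :
    (z : F) ∈ goldRadical e (a : F) ↔
      a ^ (2 ^ e - 1) * z ^ ((2 ^ e + 1) * (2 ^ e - 1)) = 1 := by
  have := charP_two_of_algebra (F := F)
  have h1 : 2 ^ e - 1 + 1 = 2 ^ e := Nat.sub_add_cancel Nat.one_le_two_pow
  have h2 : (2 ^ e + 1) * (2 ^ e - 1) + 1 = 2 ^ (2 * e) := by
    rw [two_pow_add_one_mul_sub_one, Nat.sub_add_cancel Nat.one_le_two_pow]
  have h3 : (a : F) ^ 2 ^ e * z ^ 2 ^ (2 * e) =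
      a ^ (2 ^ e - 1) * z ^ ((2 ^ e + 1) * (2 ^ e - 1)) * (a * z) := by
    rw [← h2, pow_succ (z : F), ← congrArg ((a : F) ^ ·) h1]
    ring
  rw [mem_goldRadical, CharTwo.add_eq_zero, h3, ← Units.val_inj]
  push_cast
  have hne : (a * z : F) ≠ 0 := mul_ne_zero a.ne_zero z.ne_zero
  constructor
  · intro h
    apply mul_right_cancel₀ hne
    rw [one_mul, ← h]
  · intro h
    rw [h, one_mul]

lemma card_goldRadical_unit (e : ℕ) (a : Fˣ) :
    Nat.card (goldRadical e (a : F)) = (Finset.univ.filter fun z : Fˣ =>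
      a ^ (2 ^ e - 1) * z ^ ((2 ^ e + 1) * (2 ^ e - 1)) = 1).card + 1 := by
  have h : (Finset.univ.filter fun z : F => z ∈ goldRadical e (a : F)) =
      insert 0 ((Finset.univ.filter fun z : Fˣ =>
        a ^ (2 ^ e - 1) * z ^ ((2 ^ e + 1) * (2 ^ e - 1)) = 1).image Units.val) := by
    ext z
    simp only [Finset.mem_filter, Finset.mem_univ, true_and, Finset.mem_insert, Finset.mem_image]
    constructor
    · intro hz
      by_cases h0 : z = 0
      · exact Or.inl h0
      · exact Or.inr ⟨Units.mk0 z h0, (unit_mem_goldRadical a _).mp hz, rfl⟩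
    · rintro (rfl | ⟨u, hu, rfl⟩)
      · exact zero_mem _
      · exact (unit_mem_goldRadical a u).mpr hu
  rw [Nat.card_eq_fintype_card, Fintype.card_subtype, h, Finset.card_insert_of_notMem (by simp),
    Finset.card_image_of_injective _ Units.val_injective]

lemma goldRadical_zero (e : ℕ) : goldRadical e (0 : F) = ⊤ := by
  ext z
  simp [mem_goldRadical]

lemma gcd_two_mul_of_even_div {m e : ℕ} (hm : 0 < m) (heven : Even (m / m.gcd e)) :
    m.gcd (2 * e) = 2 * m.gcd e := by
  obtain ⟨c, hc⟩ := heven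
  set d := m.gcd e with hd
  have hdpos : 0 < d := Nat.gcd_pos_of_pos_left _ hm
  obtain ⟨e', he'⟩ := Nat.gcd_dvd_right m e
  have hm' : m = d * (2 * c) := by
    rw [two_mul, ← hc, Nat.mul_div_cancel' (Nat.gcd_dvd_left m e)]
  rw [← hd] at he'
  have hcop : Nat.gcd (2 * c) e' = 1 := by
    have h := hd
    rw [hm', he', Nat.gcd_mul_left] at h
    exact Nat.eq_of_mul_eq_mul_left hdpos (by omega)
  have hce : Nat.gcd c e' = 1 := Nat.Coprime.coprime_mul_left hcop
  calc m.gcd (2 * e) = ((d * 2) * c).gcd ((d * 2) * e') := by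
        rw [hm', he']; ring_nf
    _ = 2 * d := by rw [Nat.gcd_mul_left, hce]; ring

section Counting

variable {m e : ℕ} (hF : Fintype.card F = 2 ^ m)

include hF

lemma card_goldRadical (hm : 0 < m) (heven : Even (m / m.gcd e)) (a : Fˣ) :
    Nat.card (goldRadical e (a : F)) =
      if ∃ z : Fˣ, a ^ (2 ^ e - 1) * z ^ ((2 ^ e + 1) * (2 ^ e - 1)) = 1
        then 2 ^ (2 * m.gcd e) else 1 := by
  rw [card_goldRadical_unit]
  split_ifs with h
  · obtain ⟨z, hz⟩ := h
    have hc := card_filter_mul_pow_eq_one hz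
    rw [two_pow_add_one_mul_sub_one, gcd_card_units hF, gcd_two_mul_of_even_div hm heven] at hc
    rw [← Nat.sub_add_cancel (Nat.one_le_two_pow (n := 2 * m.gcd e)), ← hc]
    simp only [two_pow_add_one_mul_sub_one]
    congr!
  · rw [Nat.add_eq_right, Finset.card_eq_zero, Finset.filter_eq_empty_iff]
    intro z _ hz
    exact h ⟨z, hz⟩

lemma card_goldRadical_zero : Nat.card (goldRadical e (0 : F)) = 2 ^ m := by
  rw [goldRadical_zero, AddSubgroup.card_top, Nat.card_eq_fintype_card, hF]

lemma card_goldRadical_cases (hm : 0 < m) (heven : Even (m / m.gcd e)) {a : F} (ha : a ≠ 0) :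
    Nat.card (goldRadical e a) = 2 ^ (2 * m.gcd e) ∨ Nat.card (goldRadical e a) = 1 := by
  have h := card_goldRadical hF hm heven (Units.mk0 a ha)
  rw [Units.val_mk0] at h
  rw [h]
  split_ifs <;> simp

lemma card_degenerate (hm : 0 < m) (hlt : 2 * m.gcd e < m)
    (heven : Even (m / m.gcd e)) :
    (Finset.univ.filter fun a : F =>
      Nat.card (goldRadical e a) = 2 ^ (2 * m.gcd e)).card * (2 ^ m.gcd e + 1) = 2 ^ m - 1 := by
  have hd : 0 < m.gcd e := Nat.gcd_pos_of_pos_left _ hm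
  have h1 : (Finset.univ.filter fun a : F => Nat.card (goldRadical e a) = 2 ^ (2 * m.gcd e)) =
      (Finset.univ.filter fun a : Fˣ =>
        ∃ z : Fˣ, a ^ (2 ^ e - 1) * z ^ ((2 ^ e + 1) * (2 ^ e - 1)) = 1).image Units.val := by
    ext a
    simp only [Finset.mem_filter, Finset.mem_univ, true_and, Finset.mem_image]
    by_cases ha : a = 0
    · subst ha
      rw [card_goldRadical_zero hF]
      have : 2 ^ (2 * m.gcd e) < 2 ^ m := Nat.pow_lt_pow_right (by norm_num) hlt
      simp [this.ne']
    · obtain ⟨u, rfl⟩ : ∃ u : Fˣ, (u : F) = a := ⟨Units.mk0 a ha, rfl⟩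
      rw [card_goldRadical hF hm heven]
      have : (1 : ℕ) ≠ 2 ^ (2 * m.gcd e) := (Nat.one_lt_two_pow (by omega)).ne
      simp only [ite_eq_left_iff, this, imp_false, not_not]
      constructor
      · exact fun h => ⟨u, h, rfl⟩
      · rintro ⟨v, hv, hvu⟩
        rwa [← Units.ext hvu]
  have h2 := card_filter_exists_mul_pow_eq_one (G := Fˣ) (2 ^ e - 1) (2 ^ e + 1)
  rw [two_pow_add_one_mul_sub_one, gcd_card_units hF, gcd_card_units hF,
    gcd_two_mul_of_even_div hm heven, Fintype.card_units, hF,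
    ← two_pow_add_one_mul_sub_one, ← two_pow_add_one_mul_sub_one, ← mul_assoc] at h2
  rw [h1, Finset.card_image_of_injective _ Units.val_injective]
  have h3 : 0 < 2 ^ m.gcd e - 1 := Nat.sub_pos_of_lt (Nat.one_lt_two_pow hd.ne')
  refine Nat.eq_of_mul_eq_mul_right h3 (Eq.trans ?_ h2)
  congr!

lemma card_radical_eq_card (hm : 0 < m) (hlt : 2 * m.gcd e < m) (heven : Even (m / m.gcd e))
    {a : F} : Nat.card (goldRadical e a) = 2 ^ m ↔ a = 0 := by
  constructor
  · intro h
    by_contra ha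
    have h1 : 2 ^ (2 * m.gcd e) < 2 ^ m := Nat.pow_lt_pow_right (by norm_num) hlt
    have h2 : 1 < 2 ^ m := Nat.one_lt_two_pow hm.ne'
    rcases card_goldRadical_cases hF hm heven ha with h' | h' <;> omega
  · rintro rfl
    exact card_goldRadical_zero hF

lemma card_nondegenerate (hm : 0 < m) (hlt : 2 * m.gcd e < m)
    (heven : Even (m / m.gcd e)) :
    (Finset.univ.filter fun a : F => Nat.card (goldRadical e a) = 1).card * (2 ^ m.gcd e + 1) =
      (2 ^ m - 1) * 2 ^ m.gcd e := by
  have hd : 0 < m.gcd e := Nat.gcd_pos_of_pos_left _ hm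
  have h1 : (Finset.univ.filter fun a : F => Nat.card (goldRadical e a) = 1).card +
      (Finset.univ.filter fun a : F => Nat.card (goldRadical e a) = 2 ^ (2 * m.gcd e)).card =
        2 ^ m - 1 := by
    rw [← Finset.card_union_of_disjoint, ← hF, ← Finset.card_univ,
      ← Finset.card_erase_of_mem (Finset.mem_univ (0 : F))]
    · congr 1
      ext a
      simp only [Finset.mem_union, Finset.mem_filter, Finset.mem_univ, true_and, Finset.mem_erase,
        and_true]
      constructor
      · rintro h rfl
        rw [card_goldRadical_zero hF] at h
        have h1 : 2 ^ (2 * m.gcd e) < 2 ^ m := Nat.pow_lt_pow_right (by norm_num) hlt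
        have h2 : 1 < 2 ^ m := Nat.one_lt_two_pow hm.ne'
        omega
      · intro ha
        exact (card_goldRadical_cases hF hm heven ha).symm
    · rw [Finset.disjoint_filter]
      intro a _ h1 h2
      have : (1 : ℕ) < 2 ^ (2 * m.gcd e) := Nat.one_lt_two_pow (by omega)
      omega
  have h2 := card_degenerate hF hm hlt heven
  have h3 := congrArg (· * (2 ^ m.gcd e + 1)) h1
  simp only [add_mul _ _ (2 ^ m.gcd e + 1), h2] at h3
  rw [mul_add_one (2 ^ m - 1)] at h3
  omega

lemma card_goldSum_sq_eq {κ : ℕ} (hκ : 0 < κ) :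
    (Finset.univ.filter fun p : F × F => goldSum e p.1 p.2 ^ 2 = 2 ^ m * κ).card * κ =
      (Finset.univ.filter fun a : F => Nat.card (goldRadical e a) = κ).card * 2 ^ m := by
  have hiff : ∀ a b : F, goldSum e a b ^ 2 = 2 ^ m * κ ↔ Nat.card (goldRadical e a) = κ ∧
      goldSum e a b ^ 2 = Fintype.card F * Nat.card (goldRadical e a) := by
    intro a b
    have hF' : (Fintype.card F : ℤ) = 2 ^ m := by exact_mod_cast hF
    constructor
    · intro h
      have hpos : (0 : ℤ) < 2 ^ m * κ := by positivity
      rcases goldSum_sq_eq_or e a b with h' | h'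
      · omega
      · refine ⟨?_, h'⟩
        rw [h, hF'] at h'
        exact_mod_cast (mul_left_cancel₀ (by positivity) h').symm
    · rintro ⟨rfl, h⟩
      rw [h, hF']
  rw [Finset.card_filter, Fintype.sum_prod_type, Finset.card_filter, Finset.sum_mul, Finset.sum_mul]
  refine Finset.sum_congr rfl fun a _ => ?_
  simp only [hiff]
  split_ifs with h
  · have h' := card_goldSum_sq_mul e a
    rw [Finset.card_filter, hF, h] at h'
    simp only [h, true_and, hF, one_mul]
    exact h'
  · simp only [h, false_and, if_false, Finset.sum_const_zero, zero_mul]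

lemma card_goldSum_sq_degenerate (hm : 0 < m) (hlt : 2 * m.gcd e < m)
    (heven : Even (m / m.gcd e)) :
    (Finset.univ.filter fun p : F × F =>
        goldSum e p.1 p.2 ^ 2 = 2 ^ (m + 2 * m.gcd e)).card *
      (2 ^ (2 * m.gcd e) * (2 ^ m.gcd e + 1)) = 2 ^ m * (2 ^ m - 1) := by
  have h := card_goldSum_sq_eq (e := e) hF (κ := 2 ^ (2 * m.gcd e)) (by positivity)
  rw [← mul_assoc, pow_add]
  push_cast at h
  rw [h, mul_right_comm, card_degenerate hF hm hlt heven, mul_comm]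

lemma card_goldSum_sq_nondegenerate (hm : 0 < m) (hlt : 2 * m.gcd e < m)
    (heven : Even (m / m.gcd e)) :
    (Finset.univ.filter fun p : F × F => goldSum e p.1 p.2 ^ 2 = 2 ^ m).card *
      (2 ^ m.gcd e + 1) = 2 ^ m * (2 ^ m - 1) * 2 ^ m.gcd e := by
  have h := card_goldSum_sq_eq (e := e) hF (κ := 1) one_pos
  simp only [Nat.cast_one, mul_one] at h
  rw [h, mul_right_comm, card_nondegenerate hF hm hlt heven]
  ring

lemma card_goldSum_sq_top (hm : 0 < m) (hlt : 2 * m.gcd e < m) (heven : Even (m / m.gcd e)) :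
    (Finset.univ.filter fun p : F × F => goldSum e p.1 p.2 ^ 2 = 2 ^ (m + m)).card = 1 := by
  have h := card_goldSum_sq_eq (e := e) hF (κ := 2 ^ m) (by positivity)
  push_cast at h
  simp only [card_radical_eq_card hF hm hlt heven] at h
  rw [pow_add]
  refine Nat.eq_of_mul_eq_mul_right (show 0 < 2 ^ m by positivity) (h.trans ?_)
  congr 1
  exact Finset.card_eq_one.mpr ⟨0, by ext; simp⟩

lemma goldSum_sq_cases (hm : 0 < m) (heven : Even (m / m.gcd e)) (a b : F) :
    goldSum e a b ^ 2 = 0 ∨ goldSum e a b ^ 2 = 2 ^ m ∨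
      goldSum e a b ^ 2 = 2 ^ (m + 2 * m.gcd e) ∨ goldSum e a b ^ 2 = 2 ^ (m + m) := by
  have hF' : (Fintype.card F : ℤ) = 2 ^ m := by exact_mod_cast hF
  refine (goldSum_sq_eq_or e a b).imp id fun h => ?_
  rw [h, hF', pow_add, pow_add]
  by_cases ha : a = 0
  · subst ha
    rw [card_goldRadical_zero hF]
    simp
  · rcases card_goldRadical_cases hF hm heven ha with h' | h' <;> rw [h'] <;> simp

lemma card_goldSum_eq_zero (hm : 0 < m) (hlt : 2 * m.gcd e < m)
    (heven : Even (m / m.gcd e)) :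
    (Finset.univ.filter fun p : F × F => goldSum e p.1 p.2 ^ 2 = 0).card =
      (2 ^ m - 1) * ((2 ^ m.gcd e - 1) * 2 ^ (m - 2 * m.gcd e) + 1) := by
  have hd : 0 < m.gcd e := Nat.gcd_pos_of_pos_left _ hm
  have h1 := card_goldSum_sq_degenerate hF hm hlt heven
  have h2 := card_goldSum_sq_nondegenerate hF hm hlt heven
  have h3 := card_goldSum_sq_top hF hm hlt heven
  have hz : (2 : ℤ) ^ m ≠ 0 := by positivity
  have hlt1 : (2 : ℤ) ^ m < 2 ^ (m + 2 * m.gcd e) :=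
    pow_lt_pow_right₀ (by norm_num) (by omega)
  have hlt2 : (2 : ℤ) ^ (m + 2 * m.gcd e) < 2 ^ (m + m) :=
    pow_lt_pow_right₀ (by norm_num) (by omega)
  have hpos : (0 : ℤ) < 2 ^ m := by positivity
  have hsum : (Finset.univ.filter fun p : F × F => goldSum e p.1 p.2 ^ 2 = 0).card +
      (Finset.univ.filter fun p : F × F => goldSum e p.1 p.2 ^ 2 = 2 ^ m).card +
      (Finset.univ.filter fun p : F × F =>
        goldSum e p.1 p.2 ^ 2 = 2 ^ (m + 2 * m.gcd e)).card +
      (Finset.univ.filter fun p : F × F => goldSum e p.1 p.2 ^ 2 = 2 ^ (m + m)).card =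
        2 ^ m * 2 ^ m := by
    rw [← hF, ← Fintype.card_prod, ← Finset.card_univ, Finset.card_eq_sum_ones Finset.univ]
    simp only [Finset.card_filter]
    rw [← Finset.sum_add_distrib, ← Finset.sum_add_distrib, ← Finset.sum_add_distrib]
    refine Finset.sum_congr rfl fun p _ => ?_
    have hc := goldSum_sq_cases hF hm heven p.1 p.2
    generalize goldSum e p.1 p.2 ^ 2 = t at *
    generalize (2 : ℤ) ^ (m + 2 * m.gcd e) = B at *
    generalize (2 : ℤ) ^ (m + m) = C at *
    generalize (2 : ℤ) ^ m = A at *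
    rcases hc with rfl | rfl | rfl | rfl
    · rw [if_pos rfl, if_neg (by omega), if_neg (by omega), if_neg (by omega)]
    · rw [if_pos rfl, if_neg (by omega), if_neg (by omega), if_neg (by omega)]
    · rw [if_pos rfl, if_neg (by omega), if_neg (by omega), if_neg (by omega)]
    · rw [if_pos rfl, if_neg (by omega), if_neg (by omega), if_neg (by omega)]
  rw [h3] at hsum
  obtain ⟨r, hr⟩ : ∃ r, r = 2 ^ (m - 2 * m.gcd e) := ⟨_, rfl⟩
  have hM : 2 ^ m = r * (2 ^ m.gcd e * 2 ^ m.gcd e) := by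
    rw [hr, ← pow_add, ← pow_add]
    congr 1
    omega
  rw [show 2 ^ (2 * m.gcd e) = 2 ^ m.gcd e * 2 ^ m.gcd e by rw [two_mul, pow_add]] at h1
  rw [← hr]
  have hq : 1 ≤ 2 ^ m.gcd e := Nat.one_le_two_pow
  have hM1 : 1 ≤ 2 ^ m := Nat.one_le_two_pow
  generalize 2 ^ m.gcd e = q at *
  generalize 2 ^ m = M at *
  generalize (Finset.univ.filter fun p : F × F => goldSum e p.1 p.2 ^ 2 = 0).card = p0 at *
  generalize (Finset.univ.filter fun p : F × F => goldSum e p.1 p.2 ^ 2 = 2 ^ m).card = p1 at *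
  generalize (Finset.univ.filter fun p : F × F =>
    goldSum e p.1 p.2 ^ 2 = 2 ^ (m + 2 * m.gcd e)).card = p2 at *
  have hr0 : 0 < r := by rw [hr]; positivity
  clear hr h3 hlt1 hlt2 hz hpos
  zify [hq, hM1] at h1 h2 hsum hM ⊢
  rw [hM] at h1 h2 hsum ⊢
  have hq0 : (0 : ℤ) < q := by exact_mod_cast hq
  have h1' : p2 * (q + 1) = r * (r * (q * q) - 1 : ℤ) := by
    apply mul_left_cancel₀ (mul_pos hq0 hq0).ne'
    linear_combination h1
  apply mul_left_cancel₀ (show (q + 1 : ℤ) ≠ 0 by omega)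
  linear_combination (q + 1 : ℤ) * hsum - h1' - h2

end Counting

/-- The word `g ↦ h + Tr(a g^{2^e+1}) + Tr(b g)`. -/
noncomputable def goldWord (e : ℕ) (a b : F) (h : ZMod 2) : F → ZMod 2 := fun g =>
  h + (Tr (a * g ^ (2 ^ e + 1)) + Tr (b * g))

lemma sum_signChar_goldWord (e : ℕ) (a b : F) (h : ZMod 2) :
    ∑ g, signChar (goldWord e a b h g) = signChar h * goldSum e a b := by
  simp only [goldWord, signChar_add h, goldSum, Finset.mul_sum]

lemma goldWord_comp_affine (e : ℕ) (a b u v : F) (h : ZMod 2) :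
    ∃ a' b' h', (fun g => goldWord e a b h (u * g + v)) = goldWord e a' b' h' := by
  obtain ⟨w, hw⟩ := surjective_pow_two_pow e (a * v + a ^ 2 ^ e * v ^ 2 ^ (2 * e))
  refine ⟨a * u ^ (2 ^ e + 1), b * u + w * u, goldWord e a b h v, funext fun g => ?_⟩
  have hT : Tr ((a * v + a ^ 2 ^ e * v ^ 2 ^ (2 * e)) * (u * g) ^ 2 ^ e) = Tr (w * u * g) := by
    rw [← hw, ← mul_pow, trace_pow_two_pow, mul_assoc]
  simp only [goldWord]
  rw [trace_polar, hT, mul_pow u g, ← mul_assoc, mul_add b, add_mul (b * u), map_add, map_add,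
    mul_assoc b u g]
  ring

omit [Fintype F] in
lemma goldWord_sub (e : ℕ) (a b a' b' : F) (h h' : ZMod 2) :
    goldWord e a b h - goldWord e a' b' h' = goldWord e (a - a') (b - b') (h - h') := by
  funext g
  simp only [goldWord, Pi.sub_apply, sub_mul, map_sub]
  ring

lemma goldWord_eq_zero {m e : ℕ} (hF : Fintype.card F = 2 ^ m) (hm : 0 < m)
    (hlt : 2 * m.gcd e < m) (heven : Even (m / m.gcd e)) {a b : F} {h : ZMod 2}
    (h0 : goldWord e a b h = 0) : a = 0 ∧ b = 0 ∧ h = 0 := by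
  have hF' : (Fintype.card F : ℤ) = 2 ^ m := by exact_mod_cast hF
  have hh : h = 0 := by simpa [goldWord] using congrFun h0 0
  subst hh
  have hS := sum_signChar_goldWord e a b 0
  simp only [h0, Pi.zero_apply, signChar_zero, one_mul, Finset.sum_const, Finset.card_univ,
    nsmul_eq_mul, mul_one] at hS
  have ha : a = 0 := by
    rw [← card_radical_eq_card hF hm hlt heven]
    have hq : (0 : ℤ) < 2 ^ m := by positivity
    rcases goldSum_sq_eq_or e a b with h' | h'
    · rw [← hS, hF'] at h'
      exact absurd h' (by positivity)
    · rw [← hS, hF', sq] at h'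
      exact_mod_cast (mul_left_cancel₀ hq.ne' h').symm
  subst ha
  refine ⟨rfl, trace_mul_left_eq_zero fun x => ?_, rfl⟩
  simpa [goldWord] using congrFun h0 x

lemma goldWord_injective {m e : ℕ} (hF : Fintype.card F = 2 ^ m) (hm : 0 < m)
    (hlt : 2 * m.gcd e < m) (heven : Even (m / m.gcd e)) :
    Function.Injective fun t : (F × F) × ZMod 2 => goldWord e t.1.1 t.1.2 t.2 := by
  rintro ⟨⟨a, b⟩, h⟩ ⟨⟨a', b'⟩, h'⟩ heq
  have := goldWord_sub e a b a' b' h h'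
  rw [sub_eq_zero.mpr heq] at this
  obtain ⟨h1, h2, h3⟩ := goldWord_eq_zero hF hm hlt heven this.symm
  rw [sub_eq_zero.mp h1, sub_eq_zero.mp h2, sub_eq_zero.mp h3]

end Field

lemma card_signChar_mul_eq {X : Type*} [Fintype X] (S : X → ℤ) {v : ℤ} (hv : v ≠ 0) :
    (Finset.univ.filter fun t : X × ZMod 2 => signChar t.2 * S t.1 = v).card =
      (Finset.univ.filter fun p : X => S p ^ 2 = v ^ 2).card := by
  rw [Finset.card_filter, Finset.card_filter, Fintype.sum_prod_type]
  refine Finset.sum_congr rfl fun p _ => ?_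
  have h1 : signChar 1 = -1 := rfl
  have : ∀ f : ZMod 2 → ℕ, ∑ h, f h = f 0 + f 1 := Fin.sum_univ_two
  rw [this]
  simp only [signChar_zero, h1, one_mul, neg_one_mul, neg_eq_iff_eq_neg, sq_eq_sq_iff_eq_or_eq_neg]
  split_ifs <;> omega

lemma card_signChar_mul_eq_zero {X : Type*} [Fintype X] (S : X → ℤ) :
    (Finset.univ.filter fun t : X × ZMod 2 => signChar t.2 * S t.1 = 0).card =
      2 * (Finset.univ.filter fun p : X => S p ^ 2 = 0).card := by
  rw [Finset.card_filter, Finset.card_filter, Fintype.sum_prod_type, Finset.mul_sum]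
  refine Finset.sum_congr rfl fun p _ => ?_
  have h1 : signChar 1 = -1 := rfl
  have : ∀ f : ZMod 2 → ℕ, ∑ h, f h = f 0 + f 1 := Fin.sum_univ_two
  rw [this]
  simp only [signChar_zero, h1, one_mul, neg_one_mul, neg_eq_zero, sq_eq_zero_iff]
  ring

lemma card_galoisField_two {m : ℕ} (hm : m ≠ 0) : Fintype.card (GaloisField 2 m) = 2 ^ m := by
  rw [← Nat.card_eq_fintype_card, GaloisField.card 2 m hm]

lemma mem_dualCode_iff {m e : ℕ} {y : GaloisField 2 m → ZMod 2} :
    y ∈ dualCode m e ↔ ∃ a b h, y = goldWord e a b h := by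
  constructor
  · intro hy
    let Φ := (parF m).prod ((phiF m 1).prod (phiF m (2 ^ e + 1)))
    let L : (GaloisField 2 m → ZMod 2) →ₗ[ZMod 2] ZMod 2 := Fintype.linearCombination (ZMod 2) y
    have hL : ∀ c, L c = ∑ g, c g * y g := fun c => by
      simp [L, Fintype.linearCombination_apply]
    have hker : LinearMap.ker Φ ≤ LinearMap.ker L := by
      intro c hc
      rw [LinearMap.mem_ker, hL]
      refine hy c ?_
      simpa [Φ, extCode, and_assoc] using hc
    obtain ⟨ψ, hψ⟩ : ∃ ψ : ZMod 2 × GaloisField 2 m × GaloisField 2 m →ₗ[ZMod 2] ZMod 2,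
        ψ ∘ₗ Φ = L := by
      have hmem : L ∈ (LinearMap.ker Φ).dualAnnihilator :=
        (Submodule.mem_dualAnnihilator L).mpr fun c hc => hker hc
      rwa [← LinearMap.range_dualMap_eq_dualAnnihilator_ker] at hmem
    obtain ⟨b, hb⟩ := exists_eq_trace_mul (ψ ∘ₗ LinearMap.inr _ _ _ ∘ₗ LinearMap.inl _ _ _)
    obtain ⟨a, ha⟩ := exists_eq_trace_mul (ψ ∘ₗ LinearMap.inr _ _ _ ∘ₗ LinearMap.inr _ _ _)
    refine ⟨a, b, ψ (1, 0, 0), funext fun g => ?_⟩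
    have h1 : L (Pi.single g 1) = y g := by
      rw [hL, Finset.sum_eq_single g] <;> simp +contextual
    have h2 : Φ (Pi.single g 1) = (1, 0, 0) + ((0, 0, g ^ (2 ^ e + 1)) + (0, g, 0)) := by
      have h3 : ∀ s, phiF m s (Pi.single g 1) = g ^ s := fun s => by
        change ∑ x, _ = _
        rw [Finset.sum_eq_single g] <;> simp +contextual
      have h4 : parF m (Pi.single g 1) = 1 := by
        change ∑ x, _ = _
        rw [Finset.sum_eq_single g] <;> simp +contextual
      simp [Φ, h3, h4]
    rw [← h1, ← hψ, LinearMap.comp_apply, h2, map_add, map_add, goldWord, ← ha, ← hb]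
    rfl
  · rintro ⟨a, b, h, rfl⟩ c hc
    simp only [extCode, Submodule.mem_inf, LinearMap.mem_ker] at hc
    obtain ⟨⟨h1, h2⟩, h3⟩ := hc
    have key : ∀ (s : ℕ) (w : GaloisField 2 m), ∑ g, c g * Algebra.trace (ZMod 2) _ (w * g ^ s) =
        Algebra.trace (ZMod 2) _ (w * phiF m s c) := by
      intro s w
      change _ = Algebra.trace (ZMod 2) _ (w * ∑ g, _)
      rw [Finset.mul_sum, map_sum]
      refine Finset.sum_congr rfl fun g _ => ?_
      rw [mul_left_comm, ← Algebra.smul_def, map_smul, smul_eq_mul]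
    have k1 := key 1 b
    have k2 := key (2 ^ e + 1) a
    rw [h2] at k1
    rw [h3] at k2
    simp only [pow_one, mul_zero, map_zero] at k1 k2
    have k3 : ∑ g, c g = 0 := h1
    simp only [goldWord, mul_add, Finset.sum_add_distrib, ← Finset.sum_mul, k1, k2, k3]
    simp

lemma comp_affine_mem_dualCode {m e : ℕ} {c : GaloisField 2 m → ZMod 2} (hc : c ∈ dualCode m e)
    (u v : GaloisField 2 m) : (fun g => c (u * g + v)) ∈ dualCode m e := by
  obtain ⟨a, b, h, rfl⟩ := mem_dualCode_iff.mp hc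
  exact mem_dualCode_iff.mpr (goldWord_comp_affine e a b u v h)

lemma wt_comp_equiv {m : ℕ} (c : GaloisField 2 m → ZMod 2)
    (π : GaloisField 2 m ≃ GaloisField 2 m) : wt (fun g => c (π g)) = wt c := by
  rw [wt, wt, Finset.card_filter, Finset.card_filter]
  exact Equiv.sum_comp π fun g => if c g ≠ 0 then 1 else 0

/-- The permutation `g ↦ u g + v` of a field, where `u ≠ 0`. -/
def affinePerm {K : Type*} [Field K] (u v : K) (hu : u ≠ 0) : K ≃ K where
  toFun g := u * g + v
  invFun g := u⁻¹ * g + -(u⁻¹ * v)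
  left_inv g := by field_simp; ring
  right_inv g := by field_simp; ring

lemma card_dualCode_pair {m e k : ℕ} {x y : GaloisField 2 m} (hxy : x ≠ y) :
    (Finset.univ.filter fun c : GaloisField 2 m → ZMod 2 =>
        (c ∈ dualCode m e ∧ wt c = k) ∧ c x ≠ 0 ∧ c y ≠ 0).card =
      (Finset.univ.filter fun c : GaloisField 2 m → ZMod 2 =>
        (c ∈ dualCode m e ∧ wt c = k) ∧ c 0 ≠ 0 ∧ c 1 ≠ 0).card := by
  let π := affinePerm (y - x) x (sub_ne_zero.mpr hxy.symm)
  have h0 : π 0 = x := by simp [π, affinePerm]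
  have h1 : π 1 = y := by simp [π, affinePerm]
  have h0' : π.symm x = 0 := by rw [← h0, π.symm_apply_apply]
  have h1' : π.symm y = 1 := by rw [← h1, π.symm_apply_apply]
  refine Finset.card_nbij' (fun c g => c (π g)) (fun c g => c (π.symm g)) ?_ ?_ ?_ ?_
  · intro c hc
    simp only [Finset.coe_filter, Finset.mem_univ, true_and, Set.mem_ofPred_eq] at hc ⊢
    rw [wt_comp_equiv, h0, h1]
    exact ⟨⟨comp_affine_mem_dualCode hc.1.1 _ _, hc.1.2⟩, hc.2⟩
  · intro c hc
    simp only [Finset.coe_filter, Finset.mem_univ, true_and, Set.mem_ofPred_eq] at hc ⊢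
    rw [wt_comp_equiv, h0', h1']
    exact ⟨⟨comp_affine_mem_dualCode hc.1.1 _ _, hc.1.2⟩, hc.2⟩
  · intro c _; simp
  · intro c _; simp

lemma card_dualCode_pair_mul {m e k : ℕ} (hm : m ≠ 0) {x y : GaloisField 2 m} (hxy : x ≠ y) :
    Nat.card {c : GaloisField 2 m → ZMod 2 // c ∈ dualCode m e ∧ wt c = k ∧ c x ≠ 0 ∧ c y ≠ 0} *
        (2 ^ m * (2 ^ m - 1)) =
      (Finset.univ.filter fun c : GaloisField 2 m → ZMod 2 =>
        c ∈ dualCode m e ∧ wt c = k).card * (k * (k - 1)) := by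
  set A := Finset.univ.filter fun c : GaloisField 2 m → ZMod 2 => c ∈ dualCode m e ∧ wt c = k
  have hN : Nat.card {c : GaloisField 2 m → ZMod 2 //
      c ∈ dualCode m e ∧ wt c = k ∧ c x ≠ 0 ∧ c y ≠ 0} =
      (A.filter fun c => c 0 ≠ 0 ∧ c 1 ≠ 0).card := by
    rw [Nat.card_eq_fintype_card, Fintype.card_subtype, Finset.filter_filter,
      ← card_dualCode_pair hxy]
    simp only [and_assoc]
  rw [hN]
  have h1 : ∑ p ∈ (Finset.univ : Finset (GaloisField 2 m)).offDiag,
      (A.filter fun c => c p.1 ≠ 0 ∧ c p.2 ≠ 0).card =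
      (A.filter fun c => c 0 ≠ 0 ∧ c 1 ≠ 0).card * (2 ^ m * (2 ^ m - 1)) := by
    rw [Finset.sum_congr rfl fun p hp => ?_, Finset.sum_const, Finset.offDiag_card,
      Finset.card_univ, card_galoisField_two hm, smul_eq_mul, mul_comm, Nat.mul_sub_one]
    rw [Finset.filter_filter, Finset.filter_filter]
    exact card_dualCode_pair (Finset.mem_offDiag.mp hp).2.2
  have h2 : ∀ c ∈ A, ((Finset.univ : Finset (GaloisField 2 m)).offDiag.filter
      fun p => c p.1 ≠ 0 ∧ c p.2 ≠ 0).card = k * (k - 1) := by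
    intro c hc
    have hw : wt c = k := (Finset.mem_filter.mp hc).2.2
    rw [← hw, Nat.mul_sub_one, wt, ← Finset.offDiag_card]
    congr 1
    ext p
    simp only [Finset.mem_filter, Finset.mem_offDiag, Finset.mem_univ, true_and]
    tauto
  rw [← h1, ← smul_eq_mul A.card, ← Finset.sum_const, ← Finset.sum_congr rfl h2]
  simp only [Finset.card_filter]
  exact Finset.sum_comm

lemma two_mul_wt_goldWord {m e : ℕ} (hm : m ≠ 0) (a b : GaloisField 2 m) (h : ZMod 2) :
    2 * (wt (goldWord e a b h) : ℤ) = 2 ^ m - signChar h * goldSum e a b := by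
  rw [← sum_signChar_goldWord]
  simp only [signChar_eq (goldWord _ _ _ _ _), Finset.sum_sub_distrib, ← Finset.mul_sum]
  rw [Finset.sum_const, Finset.card_univ, card_galoisField_two hm, wt, Finset.card_filter]
  push_cast
  ring

lemma card_dualCode_wt {m e : ℕ} (hm : 0 < m) (hlt : 2 * m.gcd e < m)
    (heven : Even (m / m.gcd e)) (k : ℕ) :
    (Finset.univ.filter fun c : GaloisField 2 m → ZMod 2 => c ∈ dualCode m e ∧ wt c = k).card =
      (Finset.univ.filter fun t : (GaloisField 2 m × GaloisField 2 m) × ZMod 2 =>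
        signChar t.2 * goldSum e t.1.1 t.1.2 = 2 ^ m - 2 * k).card := by
  rw [← Finset.card_image_of_injective _
    (goldWord_injective (card_galoisField_two hm.ne') hm hlt heven)]
  congr 1
  ext c
  simp only [Finset.mem_filter, Finset.mem_univ, true_and, Finset.mem_image, mem_dualCode_iff]
  constructor
  · rintro ⟨⟨a, b, h, rfl⟩, rfl⟩
    exact ⟨((a, b), h), by rw [two_mul_wt_goldWord hm.ne']; ring, rfl⟩
  · rintro ⟨t, ht, rfl⟩
    have := two_mul_wt_goldWord (e := e) hm.ne' t.1.1 t.1.2 t.2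
    exact ⟨⟨_, _, _, rfl⟩, by omega⟩

lemma card_pair_degenerate_weight {m e k : ℕ} (hm : 0 < m) (hlt : 2 * m.gcd e < m)
    (heven : Even (m / m.gcd e)) (hk : (2 ^ m - 2 * k : ℤ) ^ 2 = 2 ^ (m + 2 * m.gcd e))
    {x y : GaloisField 2 m} (hxy : x ≠ y) :
    Nat.card {c : GaloisField 2 m → ZMod 2 // c ∈ dualCode m e ∧ wt c = k ∧ c x ≠ 0 ∧ c y ≠ 0} =
      k * (k - 1) / (2 ^ (2 * m.gcd e) * (2 ^ m.gcd e + 1)) := by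
  refine Nat.eq_div_of_mul_eq_left (by positivity) ?_
  have h1 := card_dualCode_pair_mul (e := e) (k := k) hm.ne' hxy
  have hne : (2 ^ m - 2 * k : ℤ) ≠ 0 := by
    intro h0
    rw [h0] at hk
    exact absurd hk.symm (by positivity)
  rw [card_dualCode_wt hm hlt heven, card_signChar_mul_eq
      (fun p : GaloisField 2 m × GaloisField 2 m => goldSum e p.1 p.2) hne, hk] at h1
  have h2 := card_goldSum_sq_degenerate (card_galoisField_two hm.ne') hm hlt heven
  have hM : 0 < 2 ^ m * (2 ^ m - 1) :=
    Nat.mul_pos (by positivity) (Nat.sub_pos_of_lt (Nat.one_lt_two_pow hm.ne'))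
  refine Nat.eq_of_mul_eq_mul_right hM ?_
  rw [mul_right_comm, h1, mul_right_comm, h2, mul_comm]

lemma card_pair_nondegenerate_weight {m e k : ℕ} (hm : 0 < m) (hlt : 2 * m.gcd e < m)
    (heven : Even (m / m.gcd e)) (hk : (2 ^ m - 2 * k : ℤ) ^ 2 = 2 ^ m)
    {x y : GaloisField 2 m} (hxy : x ≠ y) :
    Nat.card {c : GaloisField 2 m → ZMod 2 // c ∈ dualCode m e ∧ wt c = k ∧ c x ≠ 0 ∧ c y ≠ 0} =
      2 ^ m.gcd e * k * (k - 1) / (2 ^ m.gcd e + 1) := by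
  refine Nat.eq_div_of_mul_eq_left (by positivity) ?_
  have h1 := card_dualCode_pair_mul (e := e) (k := k) hm.ne' hxy
  have hne : (2 ^ m - 2 * k : ℤ) ≠ 0 := by
    intro h0
    rw [h0] at hk
    exact absurd hk.symm (by positivity)
  rw [card_dualCode_wt hm hlt heven, card_signChar_mul_eq
      (fun p : GaloisField 2 m × GaloisField 2 m => goldSum e p.1 p.2) hne, hk] at h1
  have h2 := card_goldSum_sq_nondegenerate (card_galoisField_two hm.ne') hm hlt heven
  have hM : 0 < 2 ^ m * (2 ^ m - 1) :=
    Nat.mul_pos (by positivity) (Nat.sub_pos_of_lt (Nat.one_lt_two_pow hm.ne'))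
  refine Nat.eq_of_mul_eq_mul_right hM ?_
  rw [mul_right_comm, h1, mul_right_comm, h2]
  ring

lemma card_pair_half_weight {m e : ℕ} (hm : 0 < m) (hlt : 2 * m.gcd e < m)
    (heven : Even (m / m.gcd e)) {x y : GaloisField 2 m} (hxy : x ≠ y) :
    Nat.card {c : GaloisField 2 m → ZMod 2 //
        c ∈ dualCode m e ∧ wt c = 2 ^ (m - 1) ∧ c x ≠ 0 ∧ c y ≠ 0} =
      ((2 ^ m.gcd e - 1) * 2 ^ (m - 2 * m.gcd e) + 1) * (2 ^ (m - 1) - 1) := by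
  have h1 := card_dualCode_pair_mul (e := e) (k := 2 ^ (m - 1)) hm.ne' hxy
  have hk : 2 * 2 ^ (m - 1) = 2 ^ m := by rw [← pow_succ', Nat.sub_add_cancel hm]
  have h0 : (2 ^ m - 2 * (2 ^ (m - 1) : ℕ) : ℤ) = 0 := by
    rw [sub_eq_zero]
    exact_mod_cast hk.symm
  rw [card_dualCode_wt hm hlt heven, h0, card_signChar_mul_eq_zero
      (fun p : GaloisField 2 m × GaloisField 2 m => goldSum e p.1 p.2),
    card_goldSum_eq_zero (card_galoisField_two hm.ne') hm hlt heven] at h1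
  have hM : 0 < 2 ^ m * (2 ^ m - 1) :=
    Nat.mul_pos (by positivity) (Nat.sub_pos_of_lt (Nat.one_lt_two_pow hm.ne'))
  refine Nat.eq_of_mul_eq_mul_right hM (h1.trans ?_)
  rw [← hk]
  ring

/-- When `m/gcd(m,e)` is even, `1 ≤ e < m/2` and `ℓ = 2·gcd(m,e)`, the supports of
the weight-`k` codewords of `C̄_e^⊥` form 2-designs with the listed parameters
`(k,λ)`. -/
theorem dualCode_designs_even_case (m e : ℕ) (hm : 4 ≤ m)
    (he1 : 1 ≤ e) (he2 : 2 * e < m) (heven : Even (m / Nat.gcd m e))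
    (l : ℕ) (hl : l = 2 * Nat.gcd m e)
    (x y : GaloisField 2 m) (hxy : x ≠ y) :
    Nat.card {c : GaloisField 2 m → ZMod 2 // c ∈ dualCode m e ∧
        wt c = 2 ^ (m - 1) - 2 ^ ((m + l - 2) / 2) ∧ c x ≠ 0 ∧ c y ≠ 0} =
      (2 ^ (m - 1) - 2 ^ ((m + l - 2) / 2)) * (2 ^ (m - 1) - 2 ^ ((m + l - 2) / 2) - 1) /
        (2 ^ l * (2 ^ (l / 2) + 1)) ∧
    Nat.card {c : GaloisField 2 m → ZMod 2 // c ∈ dualCode m e ∧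
        wt c = 2 ^ (m - 1) + 2 ^ ((m + l - 2) / 2) ∧ c x ≠ 0 ∧ c y ≠ 0} =
      (2 ^ (m - 1) + 2 ^ ((m + l - 2) / 2)) * (2 ^ (m - 1) + 2 ^ ((m + l - 2) / 2) - 1) /
        (2 ^ l * (2 ^ (l / 2) + 1)) ∧
    Nat.card {c : GaloisField 2 m → ZMod 2 // c ∈ dualCode m e ∧
        wt c = 2 ^ (m - 1) - 2 ^ ((m - 2) / 2) ∧ c x ≠ 0 ∧ c y ≠ 0} =
      2 ^ ((m + l - 2) / 2) * (2 ^ (m / 2) - 1) * (2 ^ (m - 1) - 2 ^ ((m - 2) / 2) - 1) /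
        (2 ^ (l / 2) + 1) ∧
    Nat.card {c : GaloisField 2 m → ZMod 2 // c ∈ dualCode m e ∧
        wt c = 2 ^ (m - 1) + 2 ^ ((m - 2) / 2) ∧ c x ≠ 0 ∧ c y ≠ 0} =
      2 ^ ((m + l - 2) / 2) * (2 ^ (m / 2) + 1) * (2 ^ (m - 1) + 2 ^ ((m - 2) / 2) - 1) /
        (2 ^ (l / 2) + 1) ∧
    Nat.card {c : GaloisField 2 m → ZMod 2 // c ∈ dualCode m e ∧
        wt c = 2 ^ (m - 1) ∧ c x ≠ 0 ∧ c y ≠ 0} =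
      ((2 ^ (l / 2) - 1) * 2 ^ (m - l) + 1) * (2 ^ (m - 1) - 1) := by
  have hm0 : 0 < m := by omega
  have hd : 0 < m.gcd e := Nat.gcd_pos_of_pos_left _ hm0
  have hlt : 2 * m.gcd e < m :=
    lt_of_le_of_lt (Nat.mul_le_mul_left 2 (Nat.gcd_le_right m he1)) he2
  obtain ⟨n, hn⟩ : ∃ n, m = n + n := by
    obtain ⟨c, hc⟩ := heven
    exact ⟨m.gcd e * c, by rw [← mul_add, ← hc, Nat.mul_div_cancel' (Nat.gcd_dvd_left m e)]⟩
  have e1 : (m + l - 2) / 2 = m.gcd e + (n - 1) := by omega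
  have e2 : (m - 2) / 2 = n - 1 := by omega
  have e3 : l / 2 = m.gcd e := by omega
  have e4 : m / 2 = n := by omega
  have p1 : (2 : ℕ) ^ (m - 1) = 2 ^ (n - 1) * 2 ^ n := by
    rw [← pow_add]
    congr 1
    omega
  have p3 : (2 : ℕ) ^ (m.gcd e + (n - 1)) ≤ 2 ^ (m - 1) :=
    Nat.pow_le_pow_right (by norm_num) (by omega)
  have p4 : (2 : ℕ) ^ (n - 1) ≤ 2 ^ (m - 1) := Nat.pow_le_pow_right (by norm_num) (by omega)
  have p5 : (2 : ℤ) ^ (m - 1) * 2 = 2 ^ m := by rw [← pow_succ, Nat.sub_add_cancel hm0]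
  have p6 : (2 * 2 ^ (m.gcd e + (n - 1)) : ℤ) ^ 2 = 2 ^ (m + 2 * m.gcd e) := by
    rw [← pow_succ', ← pow_mul]
    congr 1
    omega
  have p7 : (2 * 2 ^ (n - 1) : ℤ) ^ 2 = 2 ^ m := by
    rw [← pow_succ', ← pow_mul]
    congr 1
    omega
  rw [e1, e2, e3, e4, hl]
  refine ⟨?_, ?_, ?_, ?_, card_pair_half_weight hm0 hlt heven hxy⟩
  · refine card_pair_degenerate_weight hm0 hlt heven ?_ hxy
    rw [← p6, Nat.cast_sub p3, ← p5]
    push_cast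
    ring
  · refine card_pair_degenerate_weight hm0 hlt heven ?_ hxy
    rw [← p6, ← p5]
    push_cast
    ring
  · rw [card_pair_nondegenerate_weight hm0 hlt heven _ hxy]
    · congr 2
      rw [p1, pow_add, mul_assoc, Nat.mul_sub_one]
    · rw [Nat.cast_sub p4]
      nth_rw 2 [← p7]
      rw [← p5]
      push_cast
      ring
  · rw [card_pair_nondegenerate_weight hm0 hlt heven _ hxy]
    · congr 2
      rw [p1, pow_add, mul_assoc, mul_add_one]
    · nth_rw 2 [← p7]
      rw [← p5]
      push_cast
      ring
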